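/- Let 1 ≤ n ≤ d be integers, p ∈ (1,∞), and let μ be a Radon measure on ℝ^d. Let {Q_i}_{i∈I} be a countable family of pairwise disjoint Borel subsets of ℝ^d, and for each i ∈ I let x_i ∈ ℝ^d and ℓ_i > 0 be such that Q_i is contained in the closed ball of center x_i and radius ℓ_i. Set D(i,j) = ℓ_i + ℓ_j + dist(Q_i, Q_j), Q(i) = Σ_{j∈I} ℓ_j μ(Q_j) / D(i,j)^{n+1}, and P(i) = Σ_{k≥0} 2^{−k} μ(B(x_i, 2^k ℓ_i)) / (2^k ℓ_i)^n. Then Σ_{i∈I} Q(i)^p μ(Q_i) ≤ C Σ_{i∈I} P(i)^p μ(Q_i), where C depends only on n, d and p. -/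

import Mathlib

open MeasureTheory Metric Set Filter Topology
open scoped ENNReal NNReal Classical

noncomputable section

/-- `ℝ^d` as a Euclidean space. -/
abbrev Euc (d : ℕ) : Type := EuclideanSpace ℝ (Fin d)

/-- The (extended) distance between two sets. -/
def eSetDist {α : Type*} [PseudoEMetricSpace α] (A B : Set α) : ℝ≥0∞ :=
  ⨅ a ∈ A, EMetric.infEdist a B

/-- `D(i,j) = ℓ_i + ℓ_j + dist(Q_i, Q_j)`. -/
def coefD {d : ℕ} {ι : Type*} (Q : ι → Set (Euc d)) (l : ι → ℝ) (i j : ι) : ℝ≥0∞ :=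
  ENNReal.ofReal (l i) + ENNReal.ofReal (l j) + eSetDist (Q i) (Q j)

/-- `Q(i) = Σ_j ℓ_j μ(Q_j) / D(i,j)^{n+1}`. -/
def coefQ {d : ℕ} {ι : Type*} (n : ℕ) (μ : Measure (Euc d)) (Q : ι → Set (Euc d))
    (l : ι → ℝ) (i : ι) : ℝ≥0∞ :=
  ∑' j : ι, ENNReal.ofReal (l j) * μ (Q j) / coefD Q l i j ^ (n + 1)

/-- `P(i) = Σ_{k ≥ 0} 2^{-k} μ(B(x_i, 2^k ℓ_i)) / (2^k ℓ_i)ⁿ`. -/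
def coefP {d : ℕ} {ι : Type*} (n : ℕ) (μ : Measure (Euc d)) (x : ι → Euc d)
    (l : ι → ℝ) (i : ι) : ℝ≥0∞ :=
  ∑' k : ℕ, ((2 : ℝ≥0∞) ^ k)⁻¹ *
    (μ (ball (x i) (2 ^ k * l i)) / ENNReal.ofReal ((2 ^ k * l i) ^ n))

/-- The layer-cake formula for a single extended nonnegative number. -/
lemma lintegral_layer_rpow {q : ℝ} (hq : 0 < q) (a : ℝ≥0∞) :
    ∫⁻ t in Ioi (0 : ℝ), (if ENNReal.ofReal t < a then ENNReal.ofReal (q * t ^ (q - 1)) else 0)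
      = a ^ q := by
  have key : ∀ b : ℝ, 0 ≤ b →
      ∫⁻ t in Ioi (0 : ℝ), (if ENNReal.ofReal t < ENNReal.ofReal b
        then ENNReal.ofReal (q * t ^ (q - 1)) else 0) = ENNReal.ofReal b ^ q := by
    intro b hb
    have hind : ∀ t : ℝ, t ∈ Ioi (0 : ℝ) → (if ENNReal.ofReal t < ENNReal.ofReal b
        then ENNReal.ofReal (q * t ^ (q - 1)) else 0) =
        (Iio b).indicator (fun t => ENNReal.ofReal (q * t ^ (q - 1))) t := by
      intro t ht
      have : ENNReal.ofReal t < ENNReal.ofReal b ↔ t < b :=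
        ENNReal.ofReal_lt_ofReal_iff_of_nonneg (le_of_lt ht)
      simp [indicator, this]
    rw [setLIntegral_congr_fun measurableSet_Ioi hind, lintegral_indicator measurableSet_Iio,
      Measure.restrict_restrict measurableSet_Iio, inter_comm, Ioi_inter_Iio,
      ← ofReal_integral_eq_lintegral_ofReal]
    · rw [← integral_Ioc_eq_integral_Ioo, ← intervalIntegral.integral_of_le hb,
        intervalIntegral.integral_const_mul, integral_rpow (Or.inl (by linarith)),
        ENNReal.ofReal_rpow_of_nonneg hb hq.le]
      congr 1
      rw [sub_add_cancel, Real.zero_rpow hq.ne']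
      field_simp
      simp
    · have := (intervalIntegral.intervalIntegrable_rpow' (a := 0) (b := b)
        (r := q - 1) (by linarith)).const_mul q
      rw [intervalIntegrable_iff_integrableOn_Ioo_of_le hb] at this
      exact this
    · filter_upwards [ae_restrict_mem measurableSet_Ioo] with t ht
      have := Real.rpow_nonneg ht.1.le (q - 1)
      simp only [Pi.zero_apply]
      positivity
  rcases eq_or_ne a ⊤ with rfl | ha
  · rw [ENNReal.top_rpow_of_pos hq, eq_top_iff]
    have hlim : Tendsto (fun n : ℕ => (n : ℝ≥0∞) ^ q) atTop (𝓝 ⊤) := by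
      have := (ENNReal.continuous_rpow_const (y := q)).continuousAt.tendsto.comp
        ENNReal.tendsto_nat_nhds_top
      simpa [ENNReal.top_rpow_of_pos hq, Function.comp_def] using this
    refine le_of_tendsto' hlim fun n => ?_
    have := key n n.cast_nonneg
    rw [ENNReal.ofReal_natCast] at this
    rw [← this]
    refine lintegral_mono fun t => ?_
    split_ifs <;> simp_all
  · have := key a.toReal ENNReal.toReal_nonneg
    rwa [ENNReal.ofReal_toReal ha] at this

section Maximal

variable {α ι : Type*} [MeasurableSpace α]

/-- The measure `Σ_j g_j μ|_{Q_j}`. -/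
def weightedMeasure (μ : Measure α) (Q : ι → Set α) (g : ι → ℝ≥0∞) : Measure α :=
  Measure.sum fun j => g j • μ.restrict (Q j)

lemma weightedMeasure_apply (μ : Measure α) (Q : ι → Set α) (g : ι → ℝ≥0∞) {s : Set α}
    (hs : MeasurableSet s) :
    weightedMeasure μ Q g s = ∑' j, g j * μ (s ∩ Q j) := by
  simp [weightedMeasure, Measure.sum_apply, hs, Measure.restrict_apply]

lemma weightedMeasure_univ (μ : Measure α) (Q : ι → Set α) (g : ι → ℝ≥0∞) :
    weightedMeasure μ Q g univ = ∑' j, g j * μ (Q j) := by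
  simp [weightedMeasure_apply]

/-- Splitting `g` at height `c`. -/
lemma weightedMeasure_le_add [Countable ι] (μ : Measure α) {Q : ι → Set α}
    (hQ : ∀ i, MeasurableSet (Q i)) (hd : Pairwise fun i j => Disjoint (Q i) (Q j))
    (g : ι → ℝ≥0∞) (c : ℝ≥0∞) {s : Set α} (hs : MeasurableSet s) :
    weightedMeasure μ Q g s ≤
      weightedMeasure μ Q (fun j => if c < g j then g j else 0) s + c * μ s := by
  have h2 : ∑' j, c * μ (s ∩ Q j) ≤ c * μ s := by
    rw [ENNReal.tsum_mul_left]
    gcongr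
    refine (tsum_meas_le_meas_iUnion_of_disjoint μ (fun i => hs.inter (hQ i)) ?_).trans
      (measure_mono (iUnion_subset fun i => inter_subset_left))
    exact fun i j hij => (hd hij).mono inter_subset_right inter_subset_right
  rw [weightedMeasure_apply _ _ _ hs, weightedMeasure_apply _ _ _ hs]
  refine le_trans ?_ (add_le_add_right h2 _)
  rw [← ENNReal.tsum_add]
  refine ENNReal.tsum_le_tsum fun j => ?_
  split_ifs with h
  · exact le_self_add
  · rw [zero_mul, zero_add]
    gcongr
    exact not_lt.1 h

variable [PseudoMetricSpace α] [OpensMeasurableSpace α]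

/-- A weak type `(1,1)` estimate, by the Vitali covering lemma. -/
lemma mul_tsum_measure_le_of_vitali (μ : Measure α) {Q : ι → Set α}
    (hQ : ∀ i, MeasurableSet (Q i)) (hd : Pairwise fun i j => Disjoint (Q i) (Q j))
    (ν : Measure α) (x : ι → α) (r : ι → ℝ) (t : ℝ≥0∞)
    (S : Set ι) [DecidablePred (· ∈ S)]
    (hsub : ∀ i ∈ S, Q i ⊆ closedBall (x i) (r i))
    (hS : ∀ i ∈ S, t * μ (closedBall (x i) (5 * r i)) ≤ ν (closedBall (x i) (r i))) :
    t * ∑' i, (if i ∈ S then μ (Q i) else 0) ≤ ν univ := by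
  rw [ENNReal.tsum_eq_iSup_sum, ENNReal.mul_iSup]
  refine iSup_le fun F => ?_
  rw [← Finset.sum_filter]
  set F' := F.filter (· ∈ S)
  obtain ⟨R, hR⟩ := (F'.finite_toSet.image r).bddAbove
  obtain ⟨u, huF, hud, hcov⟩ := Vitali.exists_disjoint_subfamily_covering_enlargement_closedBall
    (F' : Set ι) x r R (fun a ha => hR (mem_image_of_mem r ha)) 5 (by norm_num)
  lift u to Finset ι using F'.finite_toSet.subset huF
  have huS : ∀ i ∈ u, i ∈ S := fun i hi => (Finset.mem_filter.1 (huF hi)).2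
  calc t * ∑ i ∈ F', μ (Q i)
      = t * μ (⋃ i ∈ F', Q i) := by
        rw [measure_biUnion_finset (fun i _ j _ hij => hd hij) fun i _ => hQ i]
    _ ≤ t * μ (⋃ i ∈ u, closedBall (x i) (5 * r i)) := by
        refine mul_le_mul_right (measure_mono (iUnion₂_subset fun i hi => ?_)) t
        obtain ⟨b, hb, hib⟩ := hcov i hi
        exact ((hsub i (Finset.mem_filter.1 hi).2).trans hib).trans
          (subset_biUnion_of_mem (u := fun i => closedBall (x i) (5 * r i)) hb)
    _ ≤ t * ∑ i ∈ u, μ (closedBall (x i) (5 * r i)) := by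
        gcongr
        exact measure_biUnion_finset_le _ _
    _ ≤ ∑ i ∈ u, ν (closedBall (x i) (r i)) := by
        rw [Finset.mul_sum]
        exact Finset.sum_le_sum fun i hi => hS i (huS i hi)
    _ ≤ ν univ := by
        rw [← measure_biUnion_finset hud fun i _ => measurableSet_closedBall]
        exact measure_mono (subset_univ _)

/-- The maximal function of `Σ_j g_j 1_{Q_j}` along the balls of center `x i`, radii `r i k`. -/
def discreteMaximal (μ : Measure α) (Q : ι → Set α) (x : ι → α) (r : ι → ℕ → ℝ)
    (g : ι → ℝ≥0∞) (i : ι) : ℝ≥0∞ :=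
  ⨆ k, weightedMeasure μ Q g (closedBall (x i) (r i k)) / μ (closedBall (x i) (5 * r i k))

lemma weightedMeasure_closedBall_le_mul_discreteMaximal (μ : Measure α) (Q : ι → Set α)
    (x : ι → α) (r : ι → ℕ → ℝ) (hfin : ∀ y s, μ (closedBall y s) ≠ ⊤) (g : ι → ℝ≥0∞)
    (i : ι) (k : ℕ) (hr : 0 ≤ r i k) :
    weightedMeasure μ Q g (closedBall (x i) (r i k)) ≤
      μ (closedBall (x i) (5 * r i k)) * discreteMaximal μ Q x r g i := by
  by_cases h0 : μ (closedBall (x i) (5 * r i k)) = 0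
  · have hB : μ (closedBall (x i) (r i k)) = 0 :=
      measure_mono_null (closedBall_subset_closedBall (by linarith)) h0
    rw [weightedMeasure_apply _ _ _ measurableSet_closedBall]
    simp [measure_inter_null_of_null_left, hB]
  · rw [← ENNReal.div_le_iff' h0 (hfin _ _)]
    exact le_iSup (fun k => weightedMeasure μ Q g (closedBall (x i) (r i k)) /
      μ (closedBall (x i) (5 * r i k))) k

/-- The weak type estimate, applied to the part of `g` above the height `c`. -/
lemma mul_tsum_discreteMaximal_level_le [Countable ι] (μ : Measure α) {Q : ι → Set α}
    (hQ : ∀ i, MeasurableSet (Q i)) (hd : Pairwise fun i j => Disjoint (Q i) (Q j))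
    (x : ι → α) (r : ι → ℕ → ℝ) (hsub : ∀ i k, Q i ⊆ closedBall (x i) (r i k))
    (hfin : ∀ y s, μ (closedBall y s) ≠ ⊤) (g : ι → ℝ≥0∞) {c : ℝ≥0∞} (hc : c ≠ ⊤) :
    c * ∑' i, (if 2 * c < discreteMaximal μ Q x r g i then μ (Q i) else 0) ≤
      ∑' i, (if c < g i then g i else 0) * μ (Q i) := by
  have hex : ∀ i, ∃ k, 2 * c < discreteMaximal μ Q x r g i →
      2 * c * μ (closedBall (x i) (5 * r i k)) ≤
        weightedMeasure μ Q g (closedBall (x i) (r i k)) := by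
    intro i
    by_cases h : 2 * c < discreteMaximal μ Q x r g i
    · obtain ⟨k, hk⟩ := lt_iSup_iff.1 h
      exact ⟨k, fun _ => (ENNReal.mul_lt_of_lt_div hk).le⟩
    · exact ⟨0, fun h' => absurd h' h⟩
  choose k hk using hex
  rw [← weightedMeasure_univ]
  refine mul_tsum_measure_le_of_vitali μ hQ hd _ x (fun i => r i (k i)) c
    {i | 2 * c < discreteMaximal μ Q x r g i} (fun i _ => hsub i _) fun i hi => ?_
  have hr : 0 ≤ r i (k i) ∨ r i (k i) < 0 := le_or_gt _ _
  have hmono : μ (closedBall (x i) (r i (k i))) ≤ μ (closedBall (x i) (5 * r i (k i))) := by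
    rcases hr with hr | hr
    · exact measure_mono (closedBall_subset_closedBall (by linarith))
    · simp [closedBall_eq_empty.2 hr]
  have h1 := (hk i hi).trans (weightedMeasure_le_add μ hQ hd g c measurableSet_closedBall)
  have h2 := h1.trans (add_le_add_right (mul_le_mul_right hmono c) _)
  rw [two_mul, add_mul] at h2
  exact (ENNReal.add_le_add_iff_right (ENNReal.mul_ne_top hc (hfin _ _))).1 h2

/-- The strong type `(q,q)` estimate for the discrete maximal function. -/
lemma tsum_discreteMaximal_rpow_le [Countable ι] (μ : Measure α) {Q : ι → Set α}
    (hQ : ∀ i, MeasurableSet (Q i)) (hd : Pairwise fun i j => Disjoint (Q i) (Q j))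
    (x : ι → α) (r : ι → ℕ → ℝ) (hsub : ∀ i k, Q i ⊆ closedBall (x i) (r i k))
    (hfin : ∀ y s, μ (closedBall y s) ≠ ⊤) (g : ι → ℝ≥0∞) {q : ℝ} (hq : 1 < q) :
    ∑' i, discreteMaximal μ Q x r g i ^ q * μ (Q i) ≤
      ENNReal.ofReal (2 * q / (q - 1)) * 2 ^ (q - 1) * ∑' i, g i ^ q * μ (Q i) := by
  have hmeas : ∀ (s : ℝ) (a : ℝ≥0∞), Measurable fun t : ℝ =>
      if ENNReal.ofReal t < a then ENNReal.ofReal (s * t ^ (s - 1)) else 0 := fun s a =>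
    Measurable.ite (measurableSet_lt ENNReal.measurable_ofReal measurable_const)
      (by fun_prop) measurable_const
  have hq1 : 0 < q - 1 := by linarith
  calc ∑' i, discreteMaximal μ Q x r g i ^ q * μ (Q i)
      = ∫⁻ t in Ioi (0 : ℝ), ∑' i, (if ENNReal.ofReal t < discreteMaximal μ Q x r g i
          then ENNReal.ofReal (q * t ^ (q - 1)) else 0) * μ (Q i) := by
        rw [lintegral_tsum fun i => ((hmeas _ _).mul_const _).aemeasurable]
        refine tsum_congr fun i => ?_
        rw [lintegral_mul_const _ (hmeas _ _), lintegral_layer_rpow (by linarith)]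
    _ ≤ ∫⁻ t in Ioi (0 : ℝ), ∑' i, ENNReal.ofReal (2 * q / (q - 1)) *
          ((if ENNReal.ofReal t < 2 * g i
          then ENNReal.ofReal ((q - 1) * t ^ (q - 1 - 1)) else 0) * (g i * μ (Q i))) := by
        refine setLIntegral_mono' measurableSet_Ioi fun t ht => ?_
        have ht : 0 < t := ht
        have hw := mul_tsum_discreteMaximal_level_le μ hQ hd x r hsub hfin g
          (c := ENNReal.ofReal (t / 2)) ENNReal.ofReal_ne_top
        have h2 : 2 * ENNReal.ofReal (t / 2) = ENNReal.ofReal t := by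
          rw [← ENNReal.ofReal_ofNat, ← ENNReal.ofReal_mul (by norm_num)]
          congr 1
          ring
        have hlt : ∀ i, ENNReal.ofReal (t / 2) < g i ↔ ENNReal.ofReal t < 2 * g i := by
          intro i
          rw [← h2, ENNReal.mul_lt_mul_iff_right (by norm_num) (by norm_num)]
        simp only [h2, hlt] at hw
        have hw' := mul_le_mul_right hw (ENNReal.ofReal (2 * q * t ^ (q - 1 - 1)))
        have hpow : t ^ (q - 1) = t ^ (q - 1 - 1) * t := by
          rw [← Real.rpow_add_one ht.ne', sub_add_cancel]
        calc ∑' i, (if ENNReal.ofReal t < discreteMaximal μ Q x r g i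
              then ENNReal.ofReal (q * t ^ (q - 1)) else 0) * μ (Q i)
            = ENNReal.ofReal (2 * q * t ^ (q - 1 - 1)) * (ENNReal.ofReal (t / 2) *
              ∑' i, if ENNReal.ofReal t < discreteMaximal μ Q x r g i then μ (Q i) else 0) := by
              rw [← mul_assoc, ← ENNReal.ofReal_mul (by positivity), ← ENNReal.tsum_mul_left]
              refine tsum_congr fun i => ?_
              split_ifs
              · rw [hpow]
                ring_nf
              · simp
          _ ≤ _ := hw'
          _ = _ := by
              rw [← ENNReal.tsum_mul_left]
              refine tsum_congr fun i => ?_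
              split_ifs
              · rw [← mul_assoc (ENNReal.ofReal (2 * q / (q - 1))),
                  ← ENNReal.ofReal_mul (by positivity)]
                congr 2
                field_simp
              · simp
    _ = ∑' i, ENNReal.ofReal (2 * q / (q - 1)) * ((2 * g i) ^ (q - 1) * (g i * μ (Q i))) := by
        rw [lintegral_tsum fun i =>
          (((hmeas _ _).mul_const _).const_mul _).aemeasurable]
        refine tsum_congr fun i => ?_
        rw [lintegral_const_mul _ ((hmeas _ _).mul_const _), lintegral_mul_const _ (hmeas _ _),
          lintegral_layer_rpow hq1]
    _ = _ := by
        rw [← ENNReal.tsum_mul_left]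
        refine tsum_congr fun i => ?_
        have : g i ^ q = g i ^ (q - 1) * g i := by
          conv_lhs => rw [← sub_add_cancel q 1, ENNReal.rpow_add_of_nonneg _ _ hq1.le zero_le_one,
            ENNReal.rpow_one]
        rw [this, ENNReal.mul_rpow_of_nonneg _ _ hq1.le]
        ring

end Maximal

section Coefficients

variable {d : ℕ} {ι : Type*}

lemma subset_closedBall_of_coefD_le {Q : ι → Set (Euc d)} {x : ι → Euc d} {l : ι → ℝ}
    (hl : ∀ i, 0 < l i) (hsub : ∀ i, Q i ⊆ closedBall (x i) (l i)) {i j : ι} {R : ℝ}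
    (hR : 0 ≤ R) (h : coefD Q l i j ≤ ENNReal.ofReal R) :
    Q i ⊆ closedBall (x j) (2 * R) := by
  intro y hy
  have hkey : ∀ a ∈ Q i, ∀ b ∈ Q j, dist y (x j) ≤ 2 * l i + l j + dist a b := by
    intro a ha b hb
    have h1 := hsub i hy
    have h2 := hsub i ha
    have h3 := hsub j hb
    rw [mem_closedBall] at h1 h2 h3
    have := dist_triangle4 y a b (x j)
    have := dist_triangle_right y a (x i)
    linarith
  have hdist : ENNReal.ofReal (dist y (x j)) ≤
      ENNReal.ofReal (2 * l i + l j) + eSetDist (Q i) (Q j) := by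
    rw [← tsub_le_iff_left]
    refine le_iInf₂ fun a ha => Metric.le_infEDist.2 fun b hb => ?_
    rw [tsub_le_iff_left, edist_dist, ← ENNReal.ofReal_add _ dist_nonneg]
    · exact ENNReal.ofReal_le_ofReal (hkey a ha b hb)
    · linarith [hl i, hl j]
  have h2 : ENNReal.ofReal (2 * l i + l j) + eSetDist (Q i) (Q j) ≤ 2 * coefD Q l i j := by
    rw [coefD, ← ENNReal.ofReal_add (hl i).le (hl j).le, mul_add]
    refine add_le_add ?_ (le_mul_of_one_le_left' (by norm_num))
    rw [← ENNReal.ofReal_ofNat 2, ← ENNReal.ofReal_mul (by norm_num)]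
    exact ENNReal.ofReal_le_ofReal (by linarith [hl i, hl j])
  have h3 := (hdist.trans h2).trans (mul_le_mul_right h 2)
  have h4 : 2 * ENNReal.ofReal R = ENNReal.ofReal (2 * R) := by
    rw [ENNReal.ofReal_mul (by norm_num), ENNReal.ofReal_ofNat]
  rw [h4] at h3
  exact (ENNReal.ofReal_le_ofReal_iff (by positivity)).1 h3

/-- Dyadic decomposition of the kernel `1 / D(i,j)^m` in the size of `D(i,j) / ℓ_j`. -/
lemma measure_div_coefD_pow_le (μ : Measure (Euc d)) {Q : ι → Set (Euc d)} {x : ι → Euc d}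
    {l : ι → ℝ} (hl : ∀ i, 0 < l i) (hsub : ∀ i, Q i ⊆ closedBall (x i) (l i)) (m : ℕ)
    (hm : m ≠ 0) (i j : ι) :
    μ (Q i) / coefD Q l i j ^ m ≤
      ∑' k : ℕ, (2 / ENNReal.ofReal (2 ^ k * l j)) ^ m *
        μ (closedBall (x j) (2 * (2 ^ k * l j)) ∩ Q i) := by
  rcases eq_or_ne (coefD Q l i j) ⊤ with htop | htop
  · simp [htop, ENNReal.top_pow hm]
  set D := (coefD Q l i j).toReal with hD
  have hDD : coefD Q l i j = ENNReal.ofReal D := (ENNReal.ofReal_toReal htop).symm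
  have hlD : l j ≤ D := by
    have : ENNReal.ofReal (l j) ≤ ENNReal.ofReal D := by
      rw [← hDD, coefD]
      exact le_add_right le_add_self
    exact (ENNReal.ofReal_le_ofReal_iff ENNReal.toReal_nonneg).1 this
  have hlj := hl j
  obtain ⟨k, hk1, hk2⟩ := exists_nat_pow_near (x := D / l j) (y := 2)
    ((one_le_div hlj).2 hlD) one_lt_two
  rw [le_div_iff₀ hlj] at hk1
  rw [div_lt_iff₀ hlj] at hk2
  have hpos : (0 : ℝ) < 2 ^ (k + 1) * l j := by positivity
  have hQ : Q i ⊆ closedBall (x j) (2 * (2 ^ (k + 1) * l j)) :=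
    subset_closedBall_of_coefD_le hl hsub hpos.le (hDD ▸ ENNReal.ofReal_le_ofReal hk2.le)
  refine le_trans ?_ (ENNReal.le_tsum (k + 1))
  rw [inter_eq_self_of_subset_right hQ, div_eq_mul_inv, mul_comm, ENNReal.inv_pow]
  gcongr
  rw [hDD, ← ENNReal.ofReal_ofNat 2, ← ENNReal.ofReal_div_of_pos hpos,
    ← ENNReal.ofReal_inv_of_pos (hlj.trans_le hlD)]
  refine ENNReal.ofReal_le_ofReal ?_
  rw [inv_le_comm₀ (hlj.trans_le hlD) (by positivity), inv_div]
  rw [pow_succ]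
  linarith

lemma ofReal_mul_measure_closedBall_le_coefP_term (n : ℕ) (μ : Measure (Euc d)) (y : Euc d)
    {s : ℝ} (hs : 0 < s) (k : ℕ) :
    ENNReal.ofReal s * ((2 / ENNReal.ofReal (2 ^ k * s)) ^ (n + 1) *
        μ (closedBall y (5 * (2 * (2 ^ k * s))))) ≤
      2 ^ (5 * (n + 1)) * (((2 : ℝ≥0∞) ^ (k + 4))⁻¹ *
        (μ (ball y (2 ^ (k + 4) * s)) / ENNReal.ofReal ((2 ^ (k + 4) * s) ^ n))) := by
  have hks : 0 < 2 ^ k * s := by positivity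
  have hball : closedBall y (5 * (2 * (2 ^ k * s))) ⊆ ball y (2 ^ (k + 4) * s) :=
    closedBall_subset_ball (by rw [pow_add]; nlinarith)
  have hconst : ENNReal.ofReal s * (2 / ENNReal.ofReal (2 ^ k * s)) ^ (n + 1) =
      2 ^ (5 * (n + 1)) * (((2 : ℝ≥0∞) ^ (k + 4))⁻¹ *
        (ENNReal.ofReal ((2 ^ (k + 4) * s) ^ n))⁻¹) := by
    have h2 : (2 : ℝ≥0∞) = ENNReal.ofReal 2 := (ENNReal.ofReal_ofNat 2).symm
    rw [h2, ← ENNReal.ofReal_div_of_pos hks, ← ENNReal.ofReal_pow (by positivity),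
      ← ENNReal.ofReal_pow (by positivity), ← ENNReal.ofReal_pow (by positivity),
      ← ENNReal.ofReal_mul hs.le, ← ENNReal.ofReal_inv_of_pos (by positivity),
      ← ENNReal.ofReal_inv_of_pos (by positivity), ← ENNReal.ofReal_mul (by positivity),
      ← ENNReal.ofReal_mul (by positivity)]
    congr 1
    have hT : (0 : ℝ) < 2 ^ k := by positivity
    have h32 : (32 : ℝ) ^ n = 2 ^ n * 16 ^ n := by rw [← mul_pow]; norm_num
    rw [pow_mul, pow_add 2 k 4]
    generalize (2 : ℝ) ^ k = T at *
    norm_num only [div_pow, mul_pow, pow_succ _ n, h32]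
    field_simp
    norm_num
  calc _ = ENNReal.ofReal s * (2 / ENNReal.ofReal (2 ^ k * s)) ^ (n + 1) *
        μ (closedBall y (5 * (2 * (2 ^ k * s)))) := by ring
    _ ≤ ENNReal.ofReal s * (2 / ENNReal.ofReal (2 ^ k * s)) ^ (n + 1) *
        μ (ball y (2 ^ (k + 4) * s)) := by gcongr
    _ = _ := by
      rw [hconst, div_eq_mul_inv]
      ring

/-- By duality, `coefQ` is controlled by `coefP` times the maximal function. -/
lemma tsum_coefQ_mul_le (n : ℕ) (μ : Measure (Euc d)) (hfin : ∀ y s, μ (closedBall y s) ≠ ⊤)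
    {Q : ι → Set (Euc d)} {x : ι → Euc d} {l : ι → ℝ} (hl : ∀ i, 0 < l i)
    (hsub : ∀ i, Q i ⊆ closedBall (x i) (l i)) (g : ι → ℝ≥0∞) :
    ∑' i, coefQ n μ Q l i * (g i * μ (Q i)) ≤ 2 ^ (5 * (n + 1)) *
      ∑' j, coefP n μ x l j *
        discreteMaximal μ Q x (fun j k => 2 * (2 ^ k * l j)) g j * μ (Q j) := by
  set M := discreteMaximal μ Q x (fun j k => 2 * (2 ^ k * l j)) g with hM
  have hadj : ∀ j, ENNReal.ofReal (l j) * ∑' i, g i * (μ (Q i) / coefD Q l i j ^ (n + 1)) ≤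
      2 ^ (5 * (n + 1)) * (coefP n μ x l j * M j) := by
    intro j
    calc ENNReal.ofReal (l j) * ∑' i, g i * (μ (Q i) / coefD Q l i j ^ (n + 1))
        ≤ ENNReal.ofReal (l j) * ∑' i, g i * ∑' k : ℕ,
            (2 / ENNReal.ofReal (2 ^ k * l j)) ^ (n + 1) *
              μ (closedBall (x j) (2 * (2 ^ k * l j)) ∩ Q i) := by
          gcongr with i
          exact measure_div_coefD_pow_le μ hl hsub (n + 1) n.succ_ne_zero i j
      _ = ∑' k : ℕ, ENNReal.ofReal (l j) * ((2 / ENNReal.ofReal (2 ^ k * l j)) ^ (n + 1) *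
            weightedMeasure μ Q g (closedBall (x j) (2 * (2 ^ k * l j)))) := by
          simp_rw [weightedMeasure_apply _ _ _ measurableSet_closedBall, ← ENNReal.tsum_mul_left]
          rw [ENNReal.tsum_comm]
          exact tsum_congr fun k => tsum_congr fun i => by ring
      _ ≤ ∑' k : ℕ, 2 ^ (5 * (n + 1)) * (((2 : ℝ≥0∞) ^ (k + 4))⁻¹ *
            (μ (ball (x j) (2 ^ (k + 4) * l j)) / ENNReal.ofReal ((2 ^ (k + 4) * l j) ^ n))) *
              M j := by
          refine ENNReal.tsum_le_tsum fun k => ?_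
          refine le_trans ?_ (mul_le_mul_left
            (ofReal_mul_measure_closedBall_le_coefP_term n μ (x j) (hl j) k) (M j))
          rw [mul_assoc, mul_assoc]
          gcongr
          have hlj := hl j
          exact weightedMeasure_closedBall_le_mul_discreteMaximal μ Q x
            (fun j k => 2 * (2 ^ k * l j)) hfin g j k (by positivity)
      _ ≤ 2 ^ (5 * (n + 1)) * (coefP n μ x l j * M j) := by
          rw [ENNReal.tsum_mul_right, ENNReal.tsum_mul_left, mul_assoc]
          gcongr
          exact ENNReal.tsum_comp_le_tsum_of_injective (add_left_injective 4)
            (fun k : ℕ => ((2 : ℝ≥0∞) ^ k)⁻¹ *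
              (μ (ball (x j) (2 ^ k * l j)) / ENNReal.ofReal ((2 ^ k * l j) ^ n)))
  calc ∑' i, coefQ n μ Q l i * (g i * μ (Q i))
      = ∑' j, (ENNReal.ofReal (l j) * ∑' i, g i * (μ (Q i) / coefD Q l i j ^ (n + 1))) *
          μ (Q j) := by
        simp_rw [coefQ, ← ENNReal.tsum_mul_left, ← ENNReal.tsum_mul_right]
        rw [ENNReal.tsum_comm]
        refine tsum_congr fun j => tsum_congr fun i => ?_
        simp only [div_eq_mul_inv]
        ring
    _ ≤ ∑' j, 2 ^ (5 * (n + 1)) * (coefP n μ x l j * M j) * μ (Q j) := by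
        exact ENNReal.tsum_le_tsum fun j => mul_le_mul_left (hadj j) _
    _ = _ := by
        rw [← ENNReal.tsum_mul_left]
        exact tsum_congr fun j => by ring

end Coefficients

/-- Young's inequality with a parameter. -/
lemma ENNReal.mul_le_rpow_mul_add {p q : ℝ} (hpq : p.HolderConjugate q) {A : ℝ≥0∞}
    (hA0 : A ≠ 0) (hA : A ≠ ⊤) (a b : ℝ≥0∞) :
    a * b ≤ A ^ p * a ^ p + (A ^ q)⁻¹ * b ^ q := by
  have h := ENNReal.young_inequality (A * a) (A⁻¹ * b) hpq
  have hab : A * a * (A⁻¹ * b) = a * b := by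
    rw [mul_mul_mul_comm, ENNReal.mul_inv_cancel hA0 hA, one_mul]
  rw [hab, ENNReal.mul_rpow_of_nonneg _ _ hpq.nonneg,
    ENNReal.mul_rpow_of_nonneg _ _ hpq.symm.nonneg, ENNReal.inv_rpow] at h
  refine h.trans (add_le_add ?_ ?_) <;> refine ENNReal.div_le_of_le_mul
    (le_mul_of_one_le_right' (ENNReal.one_le_ofReal.2 ?_))
  exacts [hpq.lt.le, hpq.symm.lt.le]

/-- For a Radon measure `μ` on `ℝ^d` and a countable family of pairwise
disjoint Borel sets `Q_i ⊆ B̄(x_i, ℓ_i)`, one has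
`Σ_i Q(i)^p μ(Q_i) ≤ C Σ_i P(i)^p μ(Q_i)`, where `C` depends only on `n, d, p`. -/
theorem coefQ_le_coefP (n d : ℕ) (hn : 1 ≤ n) (hnd : n ≤ d) (p : ℝ) (hp : 1 < p) :
    ∃ C : ℝ≥0∞, 0 < C ∧ C ≠ ⊤ ∧
      ∀ (μ : Measure (Euc d)), IsLocallyFiniteMeasure μ →
        ∀ (ι : Type) (_ : Countable ι) (Q : ι → Set (Euc d)) (x : ι → Euc d) (l : ι → ℝ),
          (∀ i, MeasurableSet (Q i)) →
          (Pairwise fun i j => Disjoint (Q i) (Q j)) →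
          (∀ i, 0 < l i) →
          (∀ i, Q i ⊆ closedBall (x i) (l i)) →
          (∑' i : ι, coefQ n μ Q l i ^ p * μ (Q i)) ≤
            C * ∑' i : ι, coefP n μ x l i ^ p * μ (Q i) := by
  have hpq := Real.HolderConjugate.conjExponent hp
  set q := p.conjExponent
  have hp0 : 0 < p := hpq.pos
  have hq0 : 0 < q := hpq.symm.pos
  have hq : 1 < q := hpq.symm.lt
  set K : ℝ≥0∞ := 2 ^ (5 * (n + 1)) with hK
  set L : ℝ≥0∞ := ENNReal.ofReal (2 * q / (q - 1)) * 2 ^ (q - 1) with hL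
  have hK0 : K ≠ 0 := by positivity
  have hKt : K ≠ ⊤ := ENNReal.pow_ne_top (by norm_num)
  have hL0 : L ≠ 0 := by
    have : 0 < 2 * q / (q - 1) := div_pos (by linarith) (by linarith)
    refine mul_ne_zero (ENNReal.ofReal_pos.2 this).ne' ?_
    simp [ENNReal.rpow_eq_zero_iff]
  have hLt : L ≠ ⊤ :=
    ENNReal.mul_ne_top ENNReal.ofReal_ne_top
      (ENNReal.rpow_ne_top_of_nonneg (by linarith) (by norm_num))
  have hN0 : 2 * (K * L) ≠ 0 := mul_ne_zero (by norm_num) (mul_ne_zero hK0 hL0)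
  have hNt : 2 * (K * L) ≠ ⊤ := ENNReal.mul_ne_top (by norm_num) (ENNReal.mul_ne_top hKt hLt)
  set A : ℝ≥0∞ := (2 * (K * L)) ^ q⁻¹ with hA
  have hA0 : A ≠ 0 := (ENNReal.rpow_pos (pos_iff_ne_zero.2 hN0) hNt).ne'
  have hAt : A ≠ ⊤ := ENNReal.rpow_ne_top_of_nonneg (by positivity) hNt
  have hAq : K * ((A ^ q)⁻¹ * L) = 2⁻¹ := by
    rw [hA, ← ENNReal.rpow_mul, inv_mul_cancel₀ hq0.ne', ENNReal.rpow_one,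
      ENNReal.mul_inv (Or.inl (by norm_num)) (Or.inl (by norm_num)), mul_left_comm, mul_assoc,
      mul_left_comm, mul_left_comm,
      ENNReal.inv_mul_cancel (mul_ne_zero hK0 hL0) (ENNReal.mul_ne_top hKt hLt),
      mul_one]
  refine ⟨2 * (K * A ^ p), ?_, ?_, ?_⟩
  · exact pos_iff_ne_zero.2 (mul_ne_zero (by norm_num)
      (mul_ne_zero hK0 (ENNReal.rpow_pos (pos_iff_ne_zero.2 hA0) hAt).ne'))
  · exact ENNReal.mul_ne_top (by norm_num)
      (ENNReal.mul_ne_top hKt (ENNReal.rpow_ne_top_of_nonneg hp0.le hAt))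
  intro μ _ ι _ Q x l hQ hd hl hsub
  have hfin : ∀ y s, μ (closedBall y s) ≠ ⊤ := fun y s => measure_closedBall_lt_top.ne
  have hQfin : ∀ i, μ (Q i) ≠ ⊤ := fun i => measure_ne_top_of_subset (hsub i) (hfin _ _)
  have hsub' : ∀ i (k : ℕ), Q i ⊆ closedBall (x i) (2 * (2 ^ k * l i)) := fun i k => by
    have h1 : (1 : ℝ) ≤ 2 ^ k := one_le_pow₀ (by norm_num)
    exact (hsub i).trans (closedBall_subset_closedBall (by nlinarith [hl i]))
  set Y := ∑' i, coefP n μ x l i ^ p * μ (Q i) with hY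
  have hmain : ∀ h : ι → ℝ≥0∞, (∀ i, h i ≤ coefQ n μ Q l i) →
      ∑' i, h i ^ p * μ (Q i) ≠ ⊤ → ∑' i, h i ^ p * μ (Q i) ≤ 2 * (K * A ^ p) * Y := by
    intro h hh hX
    set X := ∑' i, h i ^ p * μ (Q i)
    set g : ι → ℝ≥0∞ := fun i => h i ^ (p - 1) with hg
    set M := discreteMaximal μ Q x (fun j k => 2 * (2 ^ k * l j)) g
    have hM : ∑' i, M i ^ q * μ (Q i) ≤ L * X := by
      have := tsum_discreteMaximal_rpow_le μ hQ hd x _ hsub' hfin g hq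
      simpa only [hg, ← ENNReal.rpow_mul, hpq.sub_one_mul_conj] using this
    have hhalf : X ≤ K * A ^ p * Y + X / 2 := calc
      X ≤ ∑' i, coefQ n μ Q l i * (g i * μ (Q i)) := by
          refine ENNReal.tsum_le_tsum fun i => ?_
          have : h i ^ p = h i * h i ^ (p - 1) := by
            conv_lhs => rw [← add_sub_cancel 1 p,
              ENNReal.rpow_add_of_nonneg _ _ zero_le_one (by linarith), ENNReal.rpow_one]
          rw [this, mul_assoc]
          exact mul_le_mul_left (hh i) _
      _ ≤ K * ∑' j, coefP n μ x l j * M j * μ (Q j) := tsum_coefQ_mul_le n μ hfin hl hsub g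
      _ ≤ K * ∑' j, (A ^ p * (coefP n μ x l j ^ p * μ (Q j)) +
            (A ^ q)⁻¹ * (M j ^ q * μ (Q j))) := by
          gcongr with j
          rw [← mul_assoc, ← mul_assoc, ← add_mul]
          gcongr
          exact ENNReal.mul_le_rpow_mul_add hpq hA0 hAt _ _
      _ ≤ K * (A ^ p * Y + (A ^ q)⁻¹ * (L * X)) := by
          rw [ENNReal.tsum_add, ENNReal.tsum_mul_left, ENNReal.tsum_mul_left]
          gcongr
      _ = K * A ^ p * Y + X / 2 := by
          rw [mul_add, ← mul_assoc, ← mul_assoc (A ^ q)⁻¹, ← mul_assoc K (_ * L), hAq,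
            div_eq_mul_inv, mul_comm X]
    have hX2 : X / 2 ≠ ⊤ := ENNReal.div_ne_top hX (by norm_num)
    have hle : X / 2 ≤ K * A ^ p * Y := by
      rw [← ENNReal.add_le_add_iff_right hX2, ENNReal.add_halves]
      exact hhalf
    calc X = 2 * (X / 2) := (ENNReal.mul_div_cancel (by norm_num) (by norm_num)).symm
      _ ≤ 2 * (K * A ^ p * Y) := by gcongr
      _ = _ := by ring
  rw [ENNReal.tsum_eq_iSup_sum]
  refine iSup_le fun F => ?_
  have hlim : Tendsto (fun N : ℕ => ∑ i ∈ F, min (coefQ n μ Q l i) N ^ p * μ (Q i)) atTop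
      (𝓝 (∑ i ∈ F, coefQ n μ Q l i ^ p * μ (Q i))) := by
    refine tendsto_finsetSum _ fun i _ => ENNReal.Tendsto.mul_const ?_ (Or.inr (hQfin i))
    refine (ENNReal.continuous_rpow_const.tendsto _).comp ?_
    simpa using (tendsto_const_nhds (x := coefQ n μ Q l i)).min ENNReal.tendsto_nat_nhds_top
  refine le_of_tendsto' hlim fun N => ?_
  set h : ι → ℝ≥0∞ := fun i => if i ∈ F then min (coefQ n μ Q l i) N else 0 with hh
  have hsum : ∑' i, h i ^ p * μ (Q i) = ∑ i ∈ F, min (coefQ n μ Q l i) N ^ p * μ (Q i) := by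
    rw [tsum_eq_sum (s := F) fun i hi => by simp [hh, hi, hp0]]
    exact Finset.sum_congr rfl fun i hi => by simp [hh, hi]
  rw [← hsum]
  refine hmain h (fun i => ?_) ?_
  · simp only [hh]
    split_ifs
    · exact min_le_left _ _
    · exact zero_le
  · rw [hsum]
    refine ENNReal.sum_ne_top.2 fun i _ => ENNReal.mul_ne_top ?_ (hQfin i)
    exact ENNReal.rpow_ne_top_of_nonneg hp0.le
      (ne_top_of_le_ne_top (ENNReal.natCast_ne_top N) (min_le_right _ _))
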